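/- For g ∈ SL₂(ℂ), the identity of formal power series ∑_{n≥0} tr(Sym^{2n} g) t^n = (1 − t²)·det(1 − t·Ad(g))^{-1} holds, where Ad(g) is the adjoint action of g on the 3-dimensional Lie algebra sl₂(ℂ). -/

import Mathlib

/-- The trace of the `d`-th symmetric power of the matrix `A`, realized as the trace of
the substitution endomorphism induced by `A` on the space of homogeneous polynomials of
degree `d` (the standard model of `Sym^d ℂ²`). -/
noncomputable def symPowTrace (n : ℕ) (A : Matrix (Fin n) (Fin n) ℂ) (d : ℕ) : ℂ :=
  LinearMap.trace ℂ (MvPolynomial.homogeneousSubmodule (Fin n) ℂ d)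
    (LinearMap.restrict
      ((MvPolynomial.homogeneousComponent d).comp
        (MvPolynomial.aeval fun i => ∑ j, A i j • (MvPolynomial.X j : MvPolynomial (Fin n) ℂ)).toLinearMap)
      (p := MvPolynomial.homogeneousSubmodule (Fin n) ℂ d)
      (q := MvPolynomial.homogeneousSubmodule (Fin n) ℂ d)
      (fun x _ => by
        simpa [MvPolynomial.mem_homogeneousSubmodule] using
          MvPolynomial.homogeneousComponent_isHomogeneous d _))

/-- Coordinates `(x, y, z) ↦ x·e + y·h + z·f` on the Lie algebra `sl₂(ℂ)` of traceless
`2 × 2` matrices. -/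
def toSL2 (v : Fin 3 → ℂ) : Matrix (Fin 2) (Fin 2) ℂ := !![v 1, v 0; v 2, -(v 1)]

lemma ad_det (g : Matrix.SpecialLinearGroup (Fin 2) ℂ)
    (AdM : Matrix (Fin 3) (Fin 3) ℂ)
    (hAd : ∀ v : Fin 3 → ℂ,
      toSL2 (AdM.mulVec v) = (g : Matrix (Fin 2) (Fin 2) ℂ) * toSL2 v *
        ((g⁻¹ : Matrix.SpecialLinearGroup (Fin 2) ℂ) : Matrix (Fin 2) (Fin 2) ℂ)) :
    (1 - (Polynomial.X : Polynomial ℂ) • AdM.map Polynomial.C).det =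
      (1 - Polynomial.X) * (1 - Polynomial.C ((g 0 0 + g 1 1)^2 - 2) * Polynomial.X + Polynomial.X ^ 2) := by
  have hd := g.det_coe
  rw [Matrix.det_fin_two] at hd
  rw [Matrix.SpecialLinearGroup.coe_inv, Matrix.adjugate_fin_two] at hAd
  rw [Matrix.eta_fin_two (g : Matrix (Fin 2) (Fin 2) ℂ)] at hAd
  generalize (g 0 0) = a at *
  generalize (g 0 1) = b at *
  generalize (g 1 0) = c at *
  generalize (g 1 1) = e at *
  have h0 := hAd ![1,0,0]
  have h1 := hAd ![0,1,0]
  have h2 := hAd ![0,0,1]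
  have e00 := congrFun₂ h0 0 1
  have e10 := congrFun₂ h0 0 0
  have e20 := congrFun₂ h0 1 0
  have e01 := congrFun₂ h1 0 1
  have e11 := congrFun₂ h1 0 0
  have e21 := congrFun₂ h1 1 0
  have e02 := congrFun₂ h2 0 1
  have e12 := congrFun₂ h2 0 0
  have e22 := congrFun₂ h2 1 0
  simp [toSL2, Matrix.mulVec, dotProduct, Fin.sum_univ_three, Matrix.mul_apply, Fin.sum_univ_two] at e00 e10 e20 e01 e11 e21 e02 e12 e22
  have hD : Polynomial.C a * Polynomial.C e - Polynomial.C b * Polynomial.C c = 1 := by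
    rw [← map_mul, ← map_mul, ← map_sub, hd, map_one]
  rw [Matrix.det_fin_three]
  simp [e00, e10, e20, e01, e11, e21, e02, e12, e22]
  have h2 : (Polynomial.C (2:ℂ)) = 2 := map_ofNat _ 2
  simp only [h2]
  generalize Polynomial.C a = a at *
  generalize Polynomial.C b = b at *
  generalize Polynomial.C c = c at *
  generalize Polynomial.C e = e at *
  generalize (Polynomial.X : Polynomial ℂ) = t at *
  obtain ⟨D, hDD⟩ : ∃ D, D = a * e - b * c := ⟨_, rfl⟩
  have hD1 : D = 1 := by rw [hDD, hD]
  trans 1 - ((a+e)^2-D) * t + D * ((a+e)^2-D) * t^2 - D^3*t^3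
  · rw [hDD]; ring
  · rw [hD1]; ring

def hh (l m : ℂ) (d : ℕ) : ℂ := ∑ p ∈ Finset.HasAntidiagonal.antidiagonal d, l ^ p.1 * m ^ p.2

lemma hh_succ (l m : ℂ) (d : ℕ) : hh l m (d+1) = l * hh l m d + m ^ (d+1) := by
  unfold hh
  rw [Finset.Nat.sum_antidiagonal_succ, Finset.mul_sum]
  simp [pow_succ, mul_comm, mul_left_comm, mul_assoc, add_comm]

lemma hh_rec (l m : ℂ) (h : l * m = 1) (d : ℕ) :
    hh l m (d+4) = ((l+m)^2-2) * hh l m (d+2) - hh l m d := by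
  have h1 := hh_succ l m d
  have h2 := hh_succ l m (d+1)
  have h3 := hh_succ l m (d+2)
  have h4 := hh_succ l m (d+3)
  have m0 : m ≠ 0 := by rintro rfl; simp at h
  have : l = m⁻¹ := by field_simp; exact h
  simp only [add_assoc, Nat.reduceAdd] at *
  rw [h4,h3,h2,h1]
  subst this
  field_simp
  ring

lemma tri (A : Matrix (Fin 2) (Fin 2) ℂ) : ∃ P Q T : Matrix (Fin 2) (Fin 2) ℂ,
    P * Q = 1 ∧ Q * P = 1 ∧ A * P = P * T ∧ T 1 0 = 0 := by
  by_cases hc : A 1 0 = 0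
  · exact ⟨1, 1, A, by simp, by simp, by simp, hc⟩
  by_cases hb : A 0 1 = 0
  · refine ⟨!![0,1;1,0], !![0,1;1,0], !![A 1 1, A 1 0; A 0 1, A 0 0], ?_, ?_, ?_, ?_⟩
    · ext i j; fin_cases i <;> fin_cases j <;> simp
    · ext i j; fin_cases i <;> fin_cases j <;> simp
    · ext i j; fin_cases i <;> fin_cases j <;> simp [Matrix.mul_apply]
    · simpa using hb
  obtain ⟨r, hr⟩ := IsAlgClosed.exists_eq_mul_self (discrim (A 0 1) (A 0 0 - A 1 1) (-A 1 0))
  obtain ⟨s, hs⟩ := exists_quadratic_eq_zero hb ⟨r, hr⟩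
  refine ⟨!![1,0;s,1], !![1,0;-s,1], !![A 0 0 + s * A 0 1, A 0 1; 0, A 1 1 - s * A 0 1], ?_, ?_, ?_, ?_⟩
  · ext i j; fin_cases i <;> fin_cases j <;> simp
  · ext i j; fin_cases i <;> fin_cases j <;> simp
  · ext i j; fin_cases i <;> fin_cases j <;> simp [Matrix.mul_apply, Fin.sum_univ_two]
    · ring
    · linear_combination -hs
  · simp

noncomputable def phi (A : Matrix (Fin 2) (Fin 2) ℂ) : MvPolynomial (Fin 2) ℂ →ₐ[ℂ] MvPolynomial (Fin 2) ℂ :=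
  MvPolynomial.aeval fun i => ∑ j, A i j • (MvPolynomial.X j : MvPolynomial (Fin 2) ℂ)

lemma phi_comp (A B : Matrix (Fin 2) (Fin 2) ℂ) : (phi A).comp (phi B) = phi (B * A) := by
  apply MvPolynomial.algHom_ext
  intro i
  simp [phi, Matrix.mul_apply, Fin.sum_univ_two, MvPolynomial.smul_eq_C_mul]
  ring

lemma phi_one : phi 1 = AlgHom.id ℂ _ := by
  apply MvPolynomial.algHom_ext
  intro i
  fin_cases i <;> simp [phi, Fin.sum_univ_two]

lemma phi_hom (A : Matrix (Fin 2) (Fin 2) ℂ) (d : ℕ) (p) (hp : p ∈ MvPolynomial.homogeneousSubmodule (Fin 2) ℂ d) :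
    phi A p ∈ MvPolynomial.homogeneousSubmodule (Fin 2) ℂ d := by
  rw [MvPolynomial.mem_homogeneousSubmodule] at *
  have := hp.aeval (fun i => ∑ j, A i j • (MvPolynomial.X j : MvPolynomial (Fin 2) ℂ)) (n := 1) ?_
  · rw [one_mul] at this
    exact this
  · intro i
    refine MvPolynomial.IsHomogeneous.sum _ _ _ fun j _ => ?_
    rw [MvPolynomial.smul_eq_C_mul]
    simpa using (MvPolynomial.isHomogeneous_C_mul_X (A i j) j)

noncomputable def phiR (A : Matrix (Fin 2) (Fin 2) ℂ) (d : ℕ) :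
    Module.End ℂ (MvPolynomial.homogeneousSubmodule (Fin 2) ℂ d) :=
  (phi A).toLinearMap.restrict (phi_hom A d)

lemma phiR_mul (A B : Matrix (Fin 2) (Fin 2) ℂ) (d : ℕ) : phiR A d * phiR B d = phiR (B * A) d := by
  ext1 x
  apply Subtype.ext
  exact DFunLike.congr_fun (phi_comp A B) x.1

lemma phiR_one (d : ℕ) : phiR 1 d = 1 := by
  ext1 x
  apply Subtype.ext
  exact DFunLike.congr_fun phi_one x.1

lemma spt_eq (A : Matrix (Fin 2) (Fin 2) ℂ) (d : ℕ) : symPowTrace 2 A d = LinearMap.trace ℂ _ (phiR A d) := by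
  unfold symPowTrace
  congr 1
  ext1 x
  apply Subtype.ext
  have := phi_hom A d x.1 x.2
  exact (MvPolynomial.homogeneousComponent_of_mem this).trans (if_pos rfl)

lemma spt_conj (A P Q T : Matrix (Fin 2) (Fin 2) ℂ) (d : ℕ) (h1 : P * Q = 1)
    (h3 : A * P = P * T) : symPowTrace 2 A d = symPowTrace 2 T d := by
  have hA : A = P * (T * Q) := by rw [← Matrix.mul_assoc, ← h3, Matrix.mul_assoc, h1, Matrix.mul_one]
  have h2 : Q * P = 1 := mul_eq_one_comm.mp h1
  rw [spt_eq, spt_eq, hA, ← phiR_mul, LinearMap.trace_mul_comm, phiR_mul, Matrix.mul_assoc, h2, Matrix.mul_one]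

lemma coeff_pow (a b : ℂ) (i : ℕ) :
    MvPolynomial.coeff (Finsupp.single 0 i) ((a • MvPolynomial.X 0 + b • MvPolynomial.X 1 : MvPolynomial (Fin 2) ℂ) ^ i) = a ^ i := by
  induction i with
  | zero => simp
  | succ i ih =>
    rw [pow_succ, mul_add, mul_smul_comm, mul_smul_comm, MvPolynomial.coeff_add, MvPolynomial.coeff_smul,
      MvPolynomial.coeff_smul, Finsupp.single_add, MvPolynomial.coeff_mul_X, ih,
      MvPolynomial.coeff_mul_X', if_neg]
    · simp [pow_succ, mul_comm]
    · simp

lemma coeff_tri (a b e : ℂ) (i j : ℕ) :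
    MvPolynomial.coeff (Finsupp.single 0 i + Finsupp.single 1 j)
      ((a • MvPolynomial.X 0 + b • MvPolynomial.X 1 : MvPolynomial (Fin 2) ℂ) ^ i *
        (e • MvPolynomial.X 1) ^ j) = a ^ i * e ^ j := by
  rw [smul_pow, mul_smul_comm, MvPolynomial.coeff_smul, MvPolynomial.X_pow_eq_monomial,
    MvPolynomial.coeff_mul_monomial, coeff_pow]
  simp [mul_comm]

lemma spt_tri (T : Matrix (Fin 2) (Fin 2) ℂ) (d : ℕ) (h : T 1 0 = 0) :
    symPowTrace 2 T d = hh (T 0 0) (T 1 1) d := by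
  classical
  rw [spt_eq]
  let s : Set (Fin 2 →₀ ℕ) := {m | m.degree = d}
  have hs : MvPolynomial.homogeneousSubmodule (Fin 2) ℂ d = MvPolynomial.restrictSupport ℂ s :=
    MvPolynomial.homogeneousSubmodule_eq_finsupp_supported _ _ _
  let b : Module.Basis s ℂ (MvPolynomial.homogeneousSubmodule (Fin 2) ℂ d) :=
    (MvPolynomial.basisRestrictSupport ℂ s).map (LinearEquiv.ofEq _ _ hs.symm)
  have hr : ∀ x m, b.repr x m = MvPolynomial.coeff m.1 x.1 := by
    intro x m
    rfl
  have hb : ∀ m, (b m : MvPolynomial (Fin 2) ℂ) = MvPolynomial.monomial m.1 1 := by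
    intro m
    have hmem : MvPolynomial.monomial m.1 (1:ℂ) ∈ MvPolynomial.homogeneousSubmodule (Fin 2) ℂ d := by
      rw [hs, MvPolynomial.monomial_mem_restrictSupport]
      exact Or.inl m.2
    have h5 : b.repr ⟨_, hmem⟩ = Finsupp.single m 1 := by
      ext k
      rw [hr, MvPolynomial.coeff_monomial, Finsupp.single_apply]
      simp only [Subtype.ext_iff]
    have h6 : b m = ⟨_, hmem⟩ := by
      apply b.repr.injective
      rw [h5, b.repr_self]
    rw [h6]
  let e : s ≃ Finset.HasAntidiagonal.antidiagonal d :=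
    { toFun m := ⟨(m.1 0, m.1 1), by
        have := m.2
        simpa [s, Finsupp.degree_eq_sum, Fin.sum_univ_two] using this⟩
      invFun p := ⟨Finsupp.equivFunOnFinite.symm ![p.1.1, p.1.2], by
        have := Finset.HasAntidiagonal.mem_antidiagonal.mp p.2
        simpa [s, Finsupp.degree_eq_sum, Fin.sum_univ_two] using this⟩
      left_inv m := by
        apply Subtype.ext
        ext i
        fin_cases i <;> simp
      right_inv p := by simp }
  have : Fintype s := Fintype.ofEquiv _ e.symm
  rw [LinearMap.trace_eq_matrix_trace ℂ b, Matrix.trace, hh,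
    ← Finset.sum_coe_sort (Finset.HasAntidiagonal.antidiagonal d) (fun p => T 0 0 ^ p.1 * T 1 1 ^ p.2)]
  refine Fintype.sum_equiv e _ _ fun m => ?_
  rw [Matrix.diag_apply, LinearMap.toMatrix_apply, hr]
  change MvPolynomial.coeff m.1 (phi T (b m).1) = T 0 0 ^ (m.1 0) * T 1 1 ^ (m.1 1)
  rw [hb]
  obtain ⟨m, hm⟩ := m
  simp only [phi, MvPolynomial.aeval_monomial, Fin.sum_univ_two, h, Finsupp.prod_fintype, pow_zero, implies_true, Fin.prod_univ_two, map_one, one_mul, zero_smul, zero_add]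
  have hm2 : m = Finsupp.single 0 (m 0) + Finsupp.single 1 (m 1) := by
    ext i
    fin_cases i <;> simp
  have := coeff_tri (T 0 0) (T 0 1) (T 1 1) (m 0) (m 1)
  rw [← hm2] at this
  exact this

/-- For `g ∈ SL₂(ℂ)`, the identity of formal power series
`∑_{n ≥ 0} tr(Sym^{2n} g) tⁿ = (1 - t²)·det(1 - t·Ad(g))⁻¹` holds, where `Ad(g)` is the
adjoint (conjugation) action of `g` on the 3-dimensional Lie algebra `sl₂(ℂ)`,
here represented by the `3 × 3` matrix `AdM` in the coordinates `toSL2`. -/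
theorem stmt2 (g : Matrix.SpecialLinearGroup (Fin 2) ℂ)
    (AdM : Matrix (Fin 3) (Fin 3) ℂ)
    (hAd : ∀ v : Fin 3 → ℂ,
      toSL2 (AdM.mulVec v) = (g : Matrix (Fin 2) (Fin 2) ℂ) * toSL2 v *
        ((g⁻¹ : Matrix.SpecialLinearGroup (Fin 2) ℂ) : Matrix (Fin 2) (Fin 2) ℂ)) :
    PowerSeries.mk (fun n => symPowTrace 2 (g : Matrix (Fin 2) (Fin 2) ℂ) (2 * n)) =
      (1 - PowerSeries.X ^ 2) *
        ((((1 - (Polynomial.X : Polynomial ℂ) • AdM.map Polynomial.C).det :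
            Polynomial ℂ) : PowerSeries ℂ))⁻¹ := by
  rw [ad_det g AdM hAd]
  obtain ⟨P, Q, T, h1, h2, h3, h4⟩ := tri g
  have hA : (g : Matrix (Fin 2) (Fin 2) ℂ) = P * (T * Q) := by rw [← Matrix.mul_assoc, ← h3, Matrix.mul_assoc, h1, Matrix.mul_one]
  have htr : g 0 0 + g 1 1 = T 0 0 + T 1 1 := by
    rw [← Matrix.trace_fin_two, ← Matrix.trace_fin_two, hA, Matrix.trace_mul_comm, Matrix.mul_assoc, h2, Matrix.mul_one]
  have hdet : T 0 0 * T 1 1 = 1 := by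
    have h5 := congrArg Matrix.det h3
    have h6 := congrArg Matrix.det h1
    simp only [Matrix.det_mul, g.det_coe, Matrix.det_one] at h5 h6
    have h7 : T.det = 1 := by linear_combination (1 - T.det) * h6 - Q.det * h5
    rw [Matrix.det_fin_two, h4] at h7
    linear_combination h7
  simp only [spt_conj _ P Q T _ h1 h3, spt_tri T _ h4]
  rw [htr]
  rw [PowerSeries.eq_mul_inv_iff_mul_eq (by simp)]
  generalize T 0 0 = l at *
  generalize T 1 1 = m at *
  have key : PowerSeries.mk (fun n => hh l m (2*n)) * (1 - PowerSeries.C ((l+m)^2-2) * PowerSeries.X + PowerSeries.X ^ 2) = 1 + PowerSeries.X := by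
    have e0 : hh l m 0 = 1 := by simp [hh]
    have e2 : hh l m 2 = (l+m)^2 - 1 := by
      rw [hh_succ, hh_succ, e0]; linear_combination -hdet
    have hrec := hh_rec l m hdet
    obtain ⟨q, hq⟩ : ∃ q, q = (l+m)^2-2 := ⟨_, rfl⟩
    have e2' : hh l m 2 = q + 1 := by rw [e2, hq]; ring
    simp only [← hq] at hrec ⊢
    ext n
    rw [mul_add, mul_sub, mul_one, ← mul_assoc, mul_comm _ (PowerSeries.C _), mul_assoc]
    rcases n with _ | _ | n
    · simp [e0]
    · simp [e0, e2', PowerSeries.coeff_X_pow, PowerSeries.coeff_succ_mul_X, PowerSeries.coeff_mul_X_pow']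
    · have := hrec (2*n)
      simp [PowerSeries.coeff_succ_mul_X, PowerSeries.coeff_mul_X_pow', PowerSeries.coeff_X, PowerSeries.coeff_one]
      rw [show 2 * (n+1+1) = 2*n+4 by ring, show 2 * (n+1) = 2*n+2 by ring, this]
      ring
  simp only [Polynomial.coe_mul, Polynomial.coe_sub, Polynomial.coe_add, Polynomial.coe_pow, Polynomial.coe_X, Polynomial.coe_one, Polynomial.coe_C]
  linear_combination (1 - PowerSeries.X) * key
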